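/- For every integer k ≥ 2, the characteristic polynomial of the 7×7 integer matrix V_k = [[2,2,2,2,2,k+1,k],[0,2,2,2,2,k,k-1],[0,0,2,2,1,0,0],[0,0,k-1,k,0,0,0],[0,1,2,2,2,0,0],[1,2,2,2,2,2k,2k-2],[1,1,1,1,1,1,1]] equals (x³-(2k+4)x²+(k+4)x-1)(x³-(k+4)x²+(2k+4)x-1)(x-1). -/

import Mathlib

open Polynomial

set_option maxHeartbeats 4000000 in
theorem det_sub_loopMatrix {R : Type*} [CommRing R] (a x : R) :
    Matrix.det !![x-2, -2, -2, -2, -2, -(a+1), -a;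
          0, x-2, -2, -2, -2, -a, -(a-1);
          0, 0, x-2, -2, -1, 0, 0;
          0, 0, -(a-1), x-a, 0, 0, 0;
          0, -1, -2, -2, x-2, 0, 0;
          -1, -2, -2, -2, -2, x-2*a, -(2*a-2);
          -1, -1, -1, -1, -1, -1, x-1]
      = (x ^ 3 - (2*a+4) * x ^ 2 + (a+4) * x - 1) *
        (x ^ 3 - (a+4) * x ^ 2 + (2*a+4) * x - 1) * (x - 1) := by
  rw [Matrix.det_succ_row _ 3]
  simp [Matrix.det_succ_row_zero, Fin.sum_univ_succ, Fin.succAbove]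
  ring

theorem stmt15 (k : ℤ) (hk : 2 ≤ k) :
    Matrix.charpoly
      (!![2, 2, 2, 2, 2, k+1, k;
          0, 2, 2, 2, 2, k, k-1;
          0, 0, 2, 2, 1, 0, 0;
          0, 0, k-1, k, 0, 0, 0;
          0, 1, 2, 2, 2, 0, 0;
          1, 2, 2, 2, 2, 2*k, 2*k-2;
          1, 1, 1, 1, 1, 1, 1] : Matrix (Fin 7) (Fin 7) ℤ)
      = (X ^ 3 - C (2*k+4) * X ^ 2 + C (k+4) * X - 1) *
        (X ^ 3 - C (k+4) * X ^ 2 + C (2*k+4) * X - 1) * (X - 1) := by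
  have h := det_sub_loopMatrix (C k) (X : ℤ[X])
  simp only [map_add, map_mul, map_ofNat]
  rw [← h, Matrix.charpoly]
  congr 1
  ext1 i j
  fin_cases i <;> fin_cases j <;> simp
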